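/- Let r > 0, set q = e^{−π√r}, and assume k_r ∈ (0,1) satisfies K(√(1 − k_r²)) = √r · K(k_r); let k'_r = √(1 − k_r²). Then ((−q;q)_∞/(q;q)_∞)² = π/(2·k'_r·K(k_r)). -/

import Mathlib

/-- The q-Pochhammer infinite product `(a; q)_∞ = ∏_{n=0}^∞ (1 - a qⁿ)`. -/
noncomputable def qPoch (a q : ℝ) : ℝ := ∏' n : ℕ, (1 - a * q ^ n)
/-- The complete elliptic integral of the first kind
`K(x) = ∫₀^{π/2} dt / √(1 - x² sin² t)`. -/
noncomputable def Kint (x : ℝ) : ℝ :=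
  ∫ t in (0 : ℝ)..(Real.pi / 2), 1 / Real.sqrt (1 - x ^ 2 * Real.sin t ^ 2)

section ThetaPart
open HurwitzZeta

noncomputable def th3 (t : ℝ) : ℝ := cosKernel ((0 : ℝ) : UnitAddCircle) t
noncomputable def th4 (t : ℝ) : ℝ := cosKernel ((1 / 2 : ℝ) : UnitAddCircle) t
noncomputable def th2 (t : ℝ) : ℝ := evenKernel ((1 / 2 : ℝ) : UnitAddCircle) t

noncomputable def gs (t x : ℝ) : ℝ := Real.exp (-Real.pi * x ^ 2 * t)

lemma th3_hasSum {t : ℝ} (ht : 0 < t) : HasSum (fun n : ℤ => gs t n) (th3 t) := by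
  have h := hasSum_int_evenKernel 0 ht
  have e : evenKernel ((0 : ℝ) : UnitAddCircle) t = th3 t := by
    have := congrFun evenKernel_eq_cosKernel_of_zero t
    simpa [th3] using this
  rw [e] at h
  simpa [gs] using h

lemma th2_hasSum {t : ℝ} (ht : 0 < t) : HasSum (fun n : ℤ => gs t (n + 1 / 2)) (th2 t) :=
  hasSum_int_evenKernel (1 / 2) ht

lemma th4_hasSum {t : ℝ} (ht : 0 < t) : HasSum (fun n : ℤ => (-1 : ℝ) ^ n * gs t n) (th4 t) := by
  have h := hasSum_int_cosKernel (1 / 2) ht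
  rw [← Complex.hasSum_ofReal]
  refine h.congr_fun fun n => ?_
  have : Complex.exp (2 * Real.pi * Complex.I * (1 / 2 : ℝ) * n) = (-1 : ℂ) ^ n := by
    rw [← Complex.exp_pi_mul_I, ← Complex.exp_int_mul]
    congr 1
    push_cast
    ring
  rw [this]
  simp [gs]

lemma th2_fe (t : ℝ) : th2 t = 1 / Real.sqrt t * th4 (1 / t) := by
  have := evenKernel_functional_equation ((1 / 2 : ℝ) : UnitAddCircle) t
  rw [← Real.sqrt_eq_rpow] at this
  exact this

lemma th3_fe (t : ℝ) : th3 t = 1 / Real.sqrt t * th3 (1 / t) := by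
  have := evenKernel_functional_equation ((0 : ℝ) : UnitAddCircle) t
  rw [← Real.sqrt_eq_rpow] at this
  have e := congrFun evenKernel_eq_cosKernel_of_zero t
  have z : ((0 : ℝ) : UnitAddCircle) = 0 := by simp
  unfold th3
  rw [z] at this ⊢
  rw [← e, this]

lemma gs_pos (t x : ℝ) : 0 < gs t x := Real.exp_pos _

lemma th3_pos {t : ℝ} (ht : 0 < t) : 0 < th3 t := by
  rw [← (th3_hasSum ht).tsum_eq]
  exact (th3_hasSum ht).summable.tsum_pos (fun n => (gs_pos _ _).le) 0 (gs_pos _ _)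

lemma th2_pos {t : ℝ} (ht : 0 < t) : 0 < th2 t := by
  rw [← (th2_hasSum ht).tsum_eq]
  exact (th2_hasSum ht).summable.tsum_pos (fun n => (gs_pos _ _).le) 0 (gs_pos _ _)

lemma th4_pos {t : ℝ} (ht : 0 < t) : 0 < th4 t := by
  have h := th2_fe (1 / t)
  have h2 := th2_pos (t := 1 / t) (by positivity)
  rw [h, one_div_one_div] at h2
  exact pos_of_mul_pos_right h2 (by positivity)

lemma cosK_tendsto (a : UnitAddCircle) : Filter.Tendsto (cosKernel a) Filter.atTop (nhds 1) := by
  obtain ⟨p, hp, h⟩ := isBigO_atTop_cosKernel_sub a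
  have h1 : Filter.Tendsto (fun x : ℝ => Real.exp (-p * x)) Filter.atTop (nhds 0) := by
    apply Real.tendsto_exp_atBot.comp
    exact Filter.tendsto_id.const_mul_atTop_of_neg (by linarith)
  have := (h.trans_tendsto h1).add_const 1
  simpa using this

lemma hasSum_mul_real {f g : ℤ → ℝ} {a b : ℝ} (hf : HasSum f a) (hg : HasSum g b) :
    HasSum (fun z : ℤ × ℤ => f z.1 * g z.2) (a * b) :=
  hf.mul hg (summable_mul_of_summable_norm hf.summable.norm hg.summable.norm)

lemma hasSum_even {F : ℤ × ℤ → ℝ} {S : ℝ} (h : HasSum F S)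
    (h0 : ∀ z : ℤ × ℤ, Odd (z.1 + z.2) → F z = 0) :
    HasSum (fun z : ℤ × ℤ => F (z.1 + z.2, z.1 - z.2)) S := by
  have hi : Function.Injective (fun z : ℤ × ℤ => (z.1 + z.2, z.1 - z.2)) := by
    rintro ⟨a, b⟩ ⟨c, d⟩ hh
    simp only [Prod.mk.injEq] at hh ⊢
    omega
  refine (hi.hasSum_iff ?_).2 h
  rintro ⟨m, n⟩ hx
  apply h0
  by_contra hne
  rw [Int.not_odd_iff_even] at hne
  obtain ⟨k, hk⟩ := hne
  simp only at hk
  exact hx ⟨(k, m - k), by simp only [Prod.mk.injEq]; omega⟩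

lemma hasSum_odd {F : ℤ × ℤ → ℝ} {S : ℝ} (h : HasSum F S)
    (h0 : ∀ z : ℤ × ℤ, Even (z.1 + z.2) → F z = 0) :
    HasSum (fun z : ℤ × ℤ => F (z.1 + z.2 + 1, z.1 - z.2)) S := by
  have hi : Function.Injective (fun z : ℤ × ℤ => (z.1 + z.2 + 1, z.1 - z.2)) := by
    rintro ⟨a, b⟩ ⟨c, d⟩ hh
    simp only [Prod.mk.injEq] at hh ⊢
    omega
  refine (hi.hasSum_iff ?_).2 h
  rintro ⟨m, n⟩ hx
  apply h0
  by_contra hne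
  rw [Int.not_even_iff_odd] at hne
  obtain ⟨k, hk⟩ := hne
  simp only at hk
  exact hx ⟨(k, m - k - 1), by simp only [Prod.mk.injEq]; omega⟩

lemma gs_mul (t a b c d : ℝ) (h : a ^ 2 + b ^ 2 = 2 * (c ^ 2 + d ^ 2)) :
    gs t a * gs t b = gs (2 * t) c * gs (2 * t) d := by
  unfold gs
  rw [← Real.exp_add, ← Real.exp_add]
  congr 1
  linear_combination (-Real.pi * t) * h

lemma sg_mul (m n : ℤ) : (-1 : ℝ) ^ m * (-1 : ℝ) ^ n = (-1 : ℝ) ^ (m + n) :=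
  (zpow_add₀ (by norm_num) m n).symm

lemma th_add {t : ℝ} (ht : 0 < t) : th3 t ^ 2 + th4 t ^ 2 = 2 * th3 (2 * t) ^ 2 := by
  have h3 := th3_hasSum ht
  have h4 := th4_hasSum ht
  have h3' := th3_hasSum (t := 2 * t) (by positivity)
  have h := (hasSum_mul_real h3 h3).add (hasSum_mul_real h4 h4)
  have h' := hasSum_even h (by
    rintro ⟨m, n⟩ ho
    have := sg_mul m n
    rw [Odd.neg_one_zpow ho] at this
    simp only
    linear_combination gs t m * gs t n * this)
  have hr := (hasSum_mul_real h3' h3').mul_left 2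
  rw [sq, sq, sq]
  refine h'.unique (hr.congr_fun ?_)
  rintro ⟨a, b⟩
  have := sg_mul (a + b) (a - b)
  rw [show a + b + (a - b) = 2 * a by ring, Even.neg_one_zpow (even_two_mul a)] at this
  have g := gs_mul t (a + b) (a - b) a b (by ring)
  push_cast
  linear_combination 2 * g + gs t (a + b) * gs t (a - b) * this

lemma th_sub {t : ℝ} (ht : 0 < t) : th3 t ^ 2 - th4 t ^ 2 = 2 * th2 (2 * t) ^ 2 := by
  have h3 := th3_hasSum ht
  have h4 := th4_hasSum ht
  have h3' := th2_hasSum (t := 2 * t) (by positivity)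
  have h := (hasSum_mul_real h3 h3).sub (hasSum_mul_real h4 h4)
  have h' := hasSum_odd h (by
    rintro ⟨m, n⟩ ho
    have := sg_mul m n
    rw [Even.neg_one_zpow ho] at this
    simp only
    linear_combination -gs t m * gs t n * this)
  have hr := (hasSum_mul_real h3' h3').mul_left 2
  rw [sq, sq, sq]
  refine h'.unique (hr.congr_fun ?_)
  rintro ⟨a, b⟩
  have := sg_mul (a + b + 1) (a - b)
  rw [show a + b + 1 + (a - b) = 2 * a + 1 by ring, Odd.neg_one_zpow (odd_two_mul_add_one a)] at this
  have g := gs_mul t (a + b + 1) (a - b) (a + 1 / 2) (b + 1 / 2) (by ring)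
  push_cast
  linear_combination 2 * g - gs t (a + b + 1) * gs t (a - b) * this

lemma th_mul {t : ℝ} (ht : 0 < t) : th3 t * th4 t = th4 (2 * t) ^ 2 := by
  have h3 := th3_hasSum ht
  have h4 := th4_hasSum ht
  have h3' := th4_hasSum (t := 2 * t) (by positivity)
  have h := (hasSum_mul_real h3 h4).add (hasSum_mul_real h4 h3)
  have h' := hasSum_even h (by
    rintro ⟨m, n⟩ ho
    have : (-1 : ℝ) ^ m + (-1 : ℝ) ^ n = 0 := by
      rw [Int.odd_add] at ho
      by_cases hm : Odd m
      · rw [hm.neg_one_zpow, (ho.1 hm).neg_one_zpow]; norm_num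
      · have hn : Odd n := by
          rw [← Int.not_even_iff_odd]; tauto
        rw [hn.neg_one_zpow, (Int.not_odd_iff_even.1 hm).neg_one_zpow]; norm_num
    simp only
    linear_combination gs t m * gs t n * this)
  have hr := (hasSum_mul_real h3' h3').mul_left 2
  have key : th3 t * th4 t + th4 t * th3 t = 2 * (th4 (2 * t) * th4 (2 * t)) := by
    refine h'.unique (hr.congr_fun ?_)
    rintro ⟨a, b⟩
    have h1 := sg_mul a b
    have h2 : (-1 : ℝ) ^ (a - b) = (-1 : ℝ) ^ (a + b) := by
      rw [show a + b = (a - b) + 2 * b by ring, zpow_add₀ (by norm_num), zpow_mul]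
      norm_num
    have g := gs_mul t (a + b) (a - b) a b (by ring)
    push_cast
    rw [h2, ← h1]
    linear_combination 2 * (-1) ^ a * (-1) ^ b * g
  linear_combination key / 2

lemma th_jacobi {t : ℝ} (ht : 0 < t) : th2 t ^ 4 + th4 t ^ 4 = th3 t ^ 4 := by
  have ht2 : 0 < t / 2 := by positivity
  have h1 := th_add ht2
  have h2 := th_sub ht2
  have h3 := th_mul ht2
  rw [mul_div_cancel₀ _ (two_ne_zero)] at h1 h2 h3
  have e2 : th2 t ^ 4 = (th2 t ^ 2) ^ 2 := by ring
  have e3 : th3 t ^ 4 = (th3 t ^ 2) ^ 2 := by ring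
  have e4 : th4 t ^ 4 = (th4 t ^ 2) ^ 2 := by ring
  rw [e2, e3, e4, ← h3, show th3 t ^ 2 = (th3 (t / 2) ^ 2 + th4 (t / 2) ^ 2) / 2 by linarith,
    show th2 t ^ 2 = (th3 (t / 2) ^ 2 - th4 (t / 2) ^ 2) / 2 by linarith]
  ring
end ThetaPart

section AgmPart
open Real

noncomputable def Iab (a b : ℝ) : ℝ :=
  ∫ t in (0 : ℝ)..(π / 2), 1 / √(a ^ 2 * cos t ^ 2 + b ^ 2 * sin t ^ 2)

lemma dab_pos {a b : ℝ} (ha : 0 < a) (hb : 0 < b) (t : ℝ) :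
    0 < a ^ 2 * cos t ^ 2 + b ^ 2 * sin t ^ 2 := by
  have h := sin_sq_add_cos_sq t
  by_cases hc : cos t = 0
  · have : sin t ^ 2 = 1 := by rw [hc] at h; linarith
    rw [hc, this]; positivity
  · positivity

lemma lab_pos {a b : ℝ} (ha : 0 < a) (hb : 0 < b) (t : ℝ) :
    0 < a * cos t ^ 2 + b * sin t ^ 2 := by
  have := dab_pos (sqrt_pos.2 ha) (sqrt_pos.2 hb) t
  rwa [sq_sqrt ha.le, sq_sqrt hb.le] at this

lemma gab_cont {a b : ℝ} (ha : 0 < a) (hb : 0 < b) :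
    Continuous (fun t => 1 / √(a ^ 2 * cos t ^ 2 + b ^ 2 * sin t ^ 2)) := by
  refine Continuous.div continuous_const (by fun_prop) fun t => ?_
  exact (sqrt_pos.2 (dab_pos ha hb t)).ne'

lemma Iab_pi {a b : ℝ} (ha : 0 < a) (hb : 0 < b) :
    ∫ t in (0 : ℝ)..π, 1 / √(a ^ 2 * cos t ^ 2 + b ^ 2 * sin t ^ 2) = 2 * Iab a b := by
  have hc := gab_cont ha hb
  rw [← intervalIntegral.integral_add_adjacent_intervals (hc.intervalIntegrable 0 (π / 2))
    (hc.intervalIntegrable (π / 2) π)]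
  have : ∫ t in (π / 2)..π, 1 / √(a ^ 2 * cos t ^ 2 + b ^ 2 * sin t ^ 2) = Iab a b := by
    have h := intervalIntegral.integral_comp_sub_left (a := 0) (b := π / 2)
      (fun t => 1 / √(a ^ 2 * cos t ^ 2 + b ^ 2 * sin t ^ 2)) π
    simp only [cos_pi_sub, sin_pi_sub, neg_sq, sub_zero] at h
    rw [show π - π / 2 = π / 2 by ring] at h
    exact h.symm
  rw [this, Iab]; ring

lemma Iab_landen {a b : ℝ} (ha : 0 < a) (hb : 0 < b) :
    Iab ((a + b) / 2) (√(a * b)) = Iab a b := by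
  set a1 := (a + b) / 2 with ha1
  set b1 := √(a * b) with hb1
  have ha1p : 0 < a1 := by positivity
  have hb1p : 0 < b1 := by positivity
  have hb1s : b1 ^ 2 = a * b := sq_sqrt (by positivity)
  let N : ℝ → ℝ := fun x => (a - b) * (sin x * cos x)
  let D : ℝ → ℝ := fun x => a * cos x ^ 2 + b * sin x ^ 2
  let R2 : ℝ → ℝ := fun x => a ^ 2 * cos x ^ 2 + b ^ 2 * sin x ^ 2
  let f : ℝ → ℝ := fun x => 2 * x - arctan (N x / D x)
  let f' : ℝ → ℝ := fun x => (a + b) * D x / R2 x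
  have hD : ∀ x, 0 < D x := lab_pos ha hb
  have hR : ∀ x, 0 < R2 x := dab_pos ha hb
  have hDN : ∀ x, D x ^ 2 + N x ^ 2 = R2 x := by
    intro x
    have h := sin_sq_add_cos_sq x
    have hs : sin x ^ 2 = 1 - cos x ^ 2 := by linarith
    simp only [D, N, R2]
    rw [mul_pow, mul_pow, hs]; ring
  have hder : ∀ x, HasDerivAt f (f' x) x := by
    intro x
    have hN : HasDerivAt N ((a - b) * (cos x * cos x + sin x * (-sin x))) x :=
      ((hasDerivAt_sin x).mul (hasDerivAt_cos x)).const_mul _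
    have hD' : HasDerivAt D (a * (2 * cos x * (-sin x)) + b * (2 * sin x * cos x)) x := by
      have h1 := ((hasDerivAt_cos x).pow 2).const_mul a
      have h2 := ((hasDerivAt_sin x).pow 2).const_mul b
      simpa using! h1.add h2
    have h := ((hasDerivAt_id x).const_mul 2).sub ((hN.div hD' (hD x).ne').arctan)
    refine h.congr_deriv ?_
    have hd := (hD x).ne'
    have hr := (hR x).ne'
    have hq : 1 + (N x / D x) ^ 2 = R2 x / D x ^ 2 := by
      rw [← hDN x]; field_simp
    rw [Pi.div_apply, hq]
    simp only [f']
    field_simp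
    have hs : sin x ^ 2 = 1 - cos x ^ 2 := by linarith [sin_sq_add_cos_sq x]
    simp only [D, N, R2]
    ring_nf
    simp only [show sin x ^ 4 = (sin x ^ 2) ^ 2 by ring, hs]
    ring
  have hcos : ∀ x, cos (f x) ^ 2 = (a * cos x ^ 2 - b * sin x ^ 2) ^ 2 / R2 x := by
    intro x
    have hd := (hD x).ne'
    have hr := hR x
    have hq : 1 + (N x / D x) ^ 2 = R2 x / D x ^ 2 := by
      rw [← hDN x]; field_simp
    have hsq : √(1 + (N x / D x) ^ 2) = √(R2 x) / D x := by
      rw [hq, sqrt_div hr.le, sqrt_sq (hD x).le]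
    have hsr := (sqrt_pos.2 hr).ne'
    have : cos (f x) = (a * cos x ^ 2 - b * sin x ^ 2) / √(R2 x) := by
      simp only [f]
      rw [cos_sub, cos_arctan, sin_arctan, hsq, cos_two_mul, sin_two_mul]
      field_simp
      have hs : sin x ^ 2 = 1 - cos x ^ 2 := by linarith [sin_sq_add_cos_sq x]
      simp only [D, N]
      ring_nf
      simp only [hs]
      ring
    rw [this, div_pow, sq_sqrt hr.le]
  have hval : ∀ x, a1 ^ 2 * cos (f x) ^ 2 + b1 ^ 2 * sin (f x) ^ 2 = (a1 * D x) ^ 2 / R2 x := by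
    intro x
    have hr := (hR x).ne'
    rw [sin_sq (f x), hcos, hb1s]
    field_simp
    have hs : sin x ^ 2 = 1 - cos x ^ 2 := by linarith [sin_sq_add_cos_sq x]
    simp only [D, R2, ha1]
    rw [hs]
    ring
  have hsub := intervalIntegral.integral_comp_mul_deriv (a := 0) (b := π / 2)
    (fun x _ => hder x) (by
      apply Continuous.continuousOn
      exact Continuous.div (by fun_prop) (by fun_prop) fun x => (hR x).ne') (gab_cont ha1p hb1p)
  have f0 : f 0 = 0 := by simp [f, N]
  have f1 : f (π / 2) = π := by simp [f, N]; ring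
  rw [f0, f1, Iab_pi ha1p hb1p] at hsub
  have : ∀ x, ((fun t => 1 / √(a1 ^ 2 * cos t ^ 2 + b1 ^ 2 * sin t ^ 2)) ∘ f) x * f' x
      = 2 * (1 / √(a ^ 2 * cos x ^ 2 + b ^ 2 * sin x ^ 2)) := by
    intro x
    have hsr := (sqrt_pos.2 (hR x)).ne'
    have hd := (hD x).ne'
    have h2 : √(R2 x) ^ 2 = R2 x := sq_sqrt (hR x).le
    simp only [Function.comp]
    rw [hval, sqrt_div (sq_nonneg _), sqrt_sq (mul_pos ha1p (hD x)).le]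
    simp only [f']
    rw [← h2]
    change _ = 2 * (1 / √(R2 x))
    rw [show a + b = 2 * a1 by rw [ha1]; ring]
    field_simp
    rw [h2]
  simp only [this] at hsub
  rw [intervalIntegral.integral_const_mul] at hsub
  have e : Iab a b = ∫ x in (0 : ℝ)..(π / 2), 1 / √(a ^ 2 * cos x ^ 2 + b ^ 2 * sin x ^ 2) := rfl
  rw [← e] at hsub
  linarith

lemma Iab_scale {a b c : ℝ} (hc : 0 < c) :
    Iab (c * a) (c * b) = Iab a b / c := by
  unfold Iab
  rw [← intervalIntegral.integral_div]
  congr 1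
  ext t
  rw [show (c * a) ^ 2 * cos t ^ 2 + (c * b) ^ 2 * sin t ^ 2
    = c ^ 2 * (a ^ 2 * cos t ^ 2 + b ^ 2 * sin t ^ 2) by ring, sqrt_mul (sq_nonneg c),
    sqrt_sq hc.le, mul_comm c, div_div]

lemma Iab_lower {a b M : ℝ} (ha : 0 < a) (hb : 0 < b) (h1 : a ≤ M) (h2 : b ≤ M) :
    π / 2 * (1 / M) ≤ Iab a b := by
  have hM : 0 < M := by linarith
  have e : ∫ t in (0 : ℝ)..(π / 2), 1 / M = π / 2 * (1 / M) := by simp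
  rw [← e]
  apply intervalIntegral.integral_mono_on (by positivity) (by simp)
    ((gab_cont ha hb).intervalIntegrable _ _)
  intro t _
  apply one_div_le_one_div_of_le (sqrt_pos.2 (dab_pos ha hb t))
  rw [sqrt_le_left hM.le]
  have h3 : a ^ 2 ≤ M ^ 2 := by gcongr
  have h4 : b ^ 2 ≤ M ^ 2 := by gcongr
  nlinarith [sin_sq_add_cos_sq t, sq_nonneg (sin t), sq_nonneg (cos t)]

lemma Iab_upper {a b m : ℝ} (hm : 0 < m) (h1 : m ≤ a) (h2 : m ≤ b) :
    Iab a b ≤ π / 2 * (1 / m) := by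
  have ha : 0 < a := by linarith
  have hb : 0 < b := by linarith
  have e : ∫ t in (0 : ℝ)..(π / 2), 1 / m = π / 2 * (1 / m) := by simp
  rw [← e]
  apply intervalIntegral.integral_mono_on (by positivity)
    ((gab_cont ha hb).intervalIntegrable _ _) (by simp)
  intro t _
  apply one_div_le_one_div_of_le hm
  apply le_sqrt_of_sq_le
  have h3 : m ^ 2 ≤ a ^ 2 := by gcongr
  have h4 : m ^ 2 ≤ b ^ 2 := by gcongr
  nlinarith [sin_sq_add_cos_sq t, sq_nonneg (sin t), sq_nonneg (cos t)]

lemma Iab_limit {u v : ℕ → ℝ} {I : ℝ} (hu : Filter.Tendsto u Filter.atTop (nhds 1))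
    (hv : Filter.Tendsto v Filter.atTop (nhds 1)) (h : ∀ n, Iab (u n) (v n) = I) :
    I = π / 2 := by
  have hmin := (hu.min hv)
  have hmax := (hu.max hv)
  rw [min_self] at hmin
  rw [max_self] at hmax
  have l1 : Filter.Tendsto (fun n => π / 2 * (1 / min (u n) (v n))) Filter.atTop
      (nhds (π / 2)) := by
    simpa using (hmin.inv₀ one_ne_zero).const_mul (π / 2)
  have l2 : Filter.Tendsto (fun n => π / 2 * (1 / max (u n) (v n))) Filter.atTop
      (nhds (π / 2)) := by
    simpa using (hmax.inv₀ one_ne_zero).const_mul (π / 2)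
  have hpos := hmin.eventually (lt_mem_nhds (zero_lt_one (α := ℝ)))
  apply le_antisymm
  · refine ge_of_tendsto l1 ?_
    filter_upwards [hpos] with n hn
    rw [← h n]
    exact Iab_upper hn (min_le_left _ _) (min_le_right _ _)
  · refine le_of_tendsto l2 ?_
    filter_upwards [hpos] with n hn
    rw [← h n]
    exact Iab_lower (hn.trans_le (min_le_left _ _)) (hn.trans_le (min_le_right _ _))
      (le_max_left _ _) (le_max_right _ _)
end AgmPart

section GaussPart
open Finset

noncomputable def PG (q : ℝ) (n : ℕ) : ℝ := ∏ i ∈ range n, (1 - q ^ (i + 1)) / (1 + q ^ (i + 1))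

noncomputable def TG (q : ℝ) (n s : ℕ) : ℝ :=
  2 * (-1) ^ s / (1 + q ^ s) * (PG q n / PG q s) * q ^ (s * (n + 1))

lemma PG_succ (q : ℝ) (n : ℕ) :
    PG q (n + 1) = PG q n * ((1 - q ^ (n + 1)) / (1 + q ^ (n + 1))) := by
  unfold PG
  rw [prod_range_succ]

lemma PG_pos {q : ℝ} (h0 : 0 < q) (h1 : q < 1) (n : ℕ) : 0 < PG q n := by
  apply prod_pos
  intro i _
  have : q ^ (i + 1) < 1 := pow_lt_one₀ h0.le h1 (by omega)
  have : 0 < 1 - q ^ (i + 1) := by linarith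
  positivity

lemma PG_anti {q : ℝ} (h0 : 0 < q) (h1 : q < 1) : Antitone (PG q) := by
  apply antitone_nat_of_succ_le
  intro n
  rw [PG_succ]
  apply mul_le_of_le_one_right (PG_pos h0 h1 n).le
  have : 0 < q ^ (n + 1) := by positivity
  rw [div_le_one (by positivity)]
  linarith

lemma TG_tele {q : ℝ} (h0 : 0 < q) (h1 : q < 1) (n m : ℕ) :
    ∑ s ∈ range (m + 1), (TG q (n + 1) s - TG q n s) =
      -(2 * (-1) ^ m * (PG q n / PG q m) * q ^ (m * (n + 1)) * (q ^ (n + 1) / (1 + q ^ (n + 1)))) := by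
  have hy : (1 + q ^ (n + 1)) ≠ 0 := by positivity
  induction m with
  | zero =>
    simp only [zero_add, sum_range_one, TG, PG_succ]
    have : PG q 0 = 1 := by simp [PG]
    rw [this]
    simp only [pow_zero, zero_mul]
    field_simp
    ring
  | succ m ih =>
    rw [sum_range_succ, ih]
    simp only [TG, PG_succ]
    have e1 : q ^ ((m + 1) * (n + 1 + 1)) = q ^ (m * (n + 1)) * q ^ (n + 1) * q ^ (m + 1) := by
      rw [← pow_add, ← pow_add]; congr 1; ring
    have e2 : q ^ ((m + 1) * (n + 1)) = q ^ (m * (n + 1)) * q ^ (n + 1) := by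
      rw [← pow_add]; congr 1; ring
    rw [e1, e2, pow_succ (-1 : ℝ) m]
    have hm := (PG_pos h0 h1 m).ne'
    have hx : q ^ (m + 1) < 1 := pow_lt_one₀ h0.le h1 (by omega)
    have hx0 : 0 < q ^ (m + 1) := by positivity
    have hy0 : 0 < q ^ (n + 1) := by positivity
    generalize q ^ (m + 1) = x at *
    generalize q ^ (n + 1) = y at *
    generalize q ^ (m * (n + 1)) = z at *
    have h3 : 1 - x ≠ 0 := by linarith
    have h4 : 1 + x ≠ 0 := by linarith
    field_simp
    ring

lemma FG_eq {q : ℝ} (h0 : 0 < q) (h1 : q < 1) (n : ℕ) :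
    ∑ s ∈ range (n + 1), TG q n s =
      1 + ∑ j ∈ range n, 2 * (-1) ^ (j + 1) * q ^ ((j + 1) ^ 2) := by
  induction n with
  | zero => simp [TG, PG]; norm_num
  | succ n ih =>
    have h := TG_tele h0 h1 n n
    rw [sum_sub_distrib] at h
    have hn := (PG_pos h0 h1 n).ne'
    have hn1 := (PG_pos h0 h1 (n + 1)).ne'
    have hy : (1 + q ^ (n + 1)) ≠ 0 := by positivity
    rw [sum_range_succ (fun s => TG q (n + 1) s), sum_range_succ (fun j => 2 * (-1 : ℝ) ^ (j + 1) * q ^ ((j + 1) ^ 2)) n, ← add_assoc, ← ih]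
    rw [div_self hn] at h
    have e : TG q (n + 1) (n + 1) = 2 * (-1) ^ (n + 1) / (1 + q ^ (n + 1)) *
      q ^ ((n + 1) ^ 2) * q ^ (n + 1) := by
      rw [TG, div_self hn1, mul_one, mul_assoc, ← pow_add]; congr 2; ring
    have e2 : q ^ ((n + 1) ^ 2) = q ^ (n * (n + 1)) * q ^ (n + 1) := by
      rw [← pow_add]; congr 1; ring
    rw [eq_add_of_sub_eq h, e, e2, pow_succ (-1 : ℝ) n]
    field_simp
    ring

lemma gauss_lim {q : ℝ} (h0 : 0 < q) (h1 : q < 1) :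
    Filter.Tendsto (fun n => (∑ s ∈ range (n + 1), TG q n s) - PG q n) Filter.atTop (nhds 0) := by
  have hb : ∀ n, |(∑ s ∈ range (n + 1), TG q n s) - PG q n| ≤ 2 * (n * q ^ n) := by
    intro n
    have hz : TG q n 0 = PG q n := by
      have : PG q 0 = 1 := by simp [PG]
      simp [TG, this]
      norm_num
    rw [sum_range_succ', hz, add_sub_cancel_right]
    refine (abs_sum_le_sum_abs _ _).trans ?_
    have : ∀ s ∈ range n, |TG q n (s + 1)| ≤ 2 * q ^ n := by
      intro s hs
      have hs' := mem_range.1 hs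
      have hp := PG_pos h0 h1 (s + 1)
      have hp' := PG_pos h0 h1 n
      rw [TG, abs_mul, abs_mul, abs_div, abs_mul, abs_pow, abs_neg, abs_one, one_pow, abs_two,
        mul_one, abs_of_pos (a := 1 + q ^ (s + 1)) (by positivity),
        abs_of_pos (a := PG q n / PG q (s + 1)) (by positivity), abs_of_pos (by positivity)]
      have a1 : 2 / (1 + q ^ (s + 1)) ≤ 2 := by
        apply div_le_self (by norm_num)
        have : 0 < q ^ (s + 1) := by positivity
        linarith
      have a2 : PG q n / PG q (s + 1) ≤ 1 := by
        rw [div_le_one hp]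
        exact PG_anti h0 h1 (by omega)
      have a3 : q ^ ((s + 1) * (n + 1)) ≤ q ^ n := by
        apply pow_le_pow_of_le_one h0.le h1.le
        nlinarith
      calc _ ≤ 2 * 1 * q ^ n := by gcongr
        _ = _ := by ring
    refine (sum_le_sum this).trans (le_of_eq ?_)
    simp; ring
  refine squeeze_zero_norm hb ?_
  simpa using (tendsto_self_mul_const_pow_of_lt_one h0.le h1).const_mul 2

lemma gauss_th4 {t : ℝ} (ht : 0 < t) (q : ℝ) (hq : q = Real.exp (-Real.pi * t)) :
    Filter.Tendsto (PG q) Filter.atTop (nhds (th4 t)) := by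
  have h0 : 0 < q := hq ▸ Real.exp_pos _
  have h1 : q < 1 := by
    rw [hq, Real.exp_lt_one_iff]
    have := mul_pos Real.pi_pos ht
    linarith
  have h := (HurwitzZeta.hasSum_nat_cosKernel₀ (1 / 2) ht).tendsto_sum_nat
  have e : ∀ n : ℕ, 2 * Real.cos (2 * Real.pi * (1 / 2) * (n + 1)) *
      Real.exp (-Real.pi * (n + 1) ^ 2 * t) = 2 * (-1) ^ (n + 1) * q ^ ((n + 1) ^ 2) := by
    intro n
    have c : Real.cos (2 * Real.pi * (1 / 2) * (n + 1)) = (-1) ^ (n + 1) := by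
      have := Real.cos_nat_mul_pi (n + 1)
      rw [← this]; congr 1; push_cast; ring
    rw [c, hq, ← Real.exp_nat_mul]
    congr 2; push_cast; ring
  simp only [e] at h
  have h2 := ((h.const_add 1).congr (fun n => (FG_eq h0 h1 n).symm)).sub (gauss_lim h0 h1)
  simp only [sub_sub_cancel] at h2
  have : (1 + (HurwitzZeta.cosKernel ((1 / 2 : ℝ) : UnitAddCircle) t - 1) - 0) = th4 t := by
    rw [th4]; ring
  rw [this] at h2
  exact h2

lemma qPoch_ratio {t : ℝ} (ht : 0 < t) (q : ℝ) (hq : q = Real.exp (-Real.pi * t)) :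
    qPoch q q / qPoch (-q) q = th4 t := by
  have h0 : 0 < q := hq ▸ Real.exp_pos _
  have h1 : q < 1 := by
    rw [hq, Real.exp_lt_one_iff]
    have := mul_pos Real.pi_pos ht
    linarith
  have hs : Summable (fun n : ℕ => q * q ^ n) := (summable_geometric_of_lt_one h0.le h1).mul_left q
  have m1 : Multipliable (fun n : ℕ => 1 - q * q ^ n) := by
    have := Real.multipliable_one_add_of_summable hs.neg
    simpa [sub_eq_add_neg] using this
  have m2 : Multipliable (fun n : ℕ => 1 - -q * q ^ n) := by
    have := Real.multipliable_one_add_of_summable hs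
    simpa using this
  have l1 := m1.hasProd.tendsto_prod_nat
  have l2 := m2.hasProd.tendsto_prod_nat
  have hge : 1 ≤ ∏' n : ℕ, (1 - -q * q ^ n) := by
    refine ge_of_tendsto' l2 fun n => ?_
    refine Finset.prod_induction _ (fun x => 1 ≤ x)
      (fun a b => one_le_mul_of_one_le_of_one_le) le_rfl ?_
    intro i _
    have : 0 < q * q ^ i := by positivity
    linarith
  have l3 := l1.div l2 (by linarith)
  refine tendsto_nhds_unique (l3.congr fun n => ?_) (gauss_th4 ht q hq)
  simp only [Pi.div_apply]
  rw [← prod_div_distrib, PG]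
  refine prod_congr rfl fun i _ => ?_
  rw [pow_succ']; ring
end GaussPart

section FinalPart
open Real

lemma Iab_theta {t : ℝ} (ht : 0 < t) : Iab (th3 t ^ 2) (th4 t ^ 2) = π / 2 := by
  have step : ∀ s : ℝ, 0 < s →
      Iab (th3 (2 * s) ^ 2) (th4 (2 * s) ^ 2) = Iab (th3 s ^ 2) (th4 s ^ 2) := by
    intro s hs
    have p3 := th3_pos hs
    have p4 := th4_pos hs
    rw [← Iab_landen (a := th3 s ^ 2) (b := th4 s ^ 2) (by positivity) (by positivity), th_add hs, ← th_mul hs, ← mul_pow,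
      sqrt_sq (by positivity), mul_div_cancel_left₀ _ two_ne_zero]
  have hall : ∀ n : ℕ, Iab (th3 (2 ^ n * t) ^ 2) (th4 (2 ^ n * t) ^ 2)
      = Iab (th3 t ^ 2) (th4 t ^ 2) := by
    intro n
    induction n with
    | zero => simp
    | succ n ih =>
      rw [← ih, show (2 : ℝ) ^ (n + 1) * t = 2 * (2 ^ n * t) by ring]
      exact step _ (by positivity)
  have hl : Filter.Tendsto (fun n : ℕ => (2 : ℝ) ^ n * t) Filter.atTop Filter.atTop :=
    (tendsto_pow_atTop_atTop_of_one_lt one_lt_two).atTop_mul_const ht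
  refine Iab_limit ?_ ?_ hall
  · simpa [th3] using ((cosK_tendsto ((0 : ℝ) : UnitAddCircle)).comp hl).pow 2
  · have := ((cosK_tendsto ((1 / 2 : ℝ) : UnitAddCircle)).comp hl).pow 2
    rw [one_pow] at this
    exact this

lemma Iab_theta' {t : ℝ} (ht : 0 < t) :
    Iab 1 (th4 t ^ 2 / th3 t ^ 2) = th3 t ^ 2 * (π / 2) := by
  have p3 := th3_pos ht
  have h := Iab_scale (a := 1) (b := th4 t ^ 2 / th3 t ^ 2) (c := th3 t ^ 2) (by positivity)
  rw [mul_one, mul_div_cancel₀ _ (by positivity), Iab_theta ht] at h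
  rw [h]; field_simp

lemma Iab_strict {b c : ℝ} (hb : 0 < b) (hbc : b < c) : Iab 1 c < Iab 1 b := by
  have hc : 0 < c := hb.trans hbc
  have hsq : b ^ 2 < c ^ 2 := by gcongr
  apply intervalIntegral.integral_lt_integral_of_continuousOn_of_le_of_exists_lt (by positivity)
    (gab_cont one_pos hc).continuousOn (gab_cont one_pos hb).continuousOn
  · intro x _
    apply one_div_le_one_div_of_le (sqrt_pos.2 (dab_pos one_pos hb x))
    apply sqrt_le_sqrt
    gcongr
  · refine ⟨π / 2, ⟨by positivity, le_rfl⟩, ?_⟩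
    simp only [cos_pi_div_two, sin_pi_div_two]
    apply one_div_lt_one_div_of_lt
    · apply sqrt_pos.2; positivity
    · apply sqrt_lt_sqrt
      · positivity
      · linarith

lemma Kint_eq {k k' : ℝ} (h : k ^ 2 + k' ^ 2 = 1) : Kint k = Iab 1 k' := by
  unfold Kint Iab
  congr 1
  ext t
  congr 2
  linear_combination (-1 : ℝ) * sin_sq_add_cos_sq t - sin t ^ 2 * h
end FinalPart

theorem stmt_10 (r : ℝ) (hr : 0 < r) (q : ℝ) (hq : q = Real.exp (-Real.pi * Real.sqrt r))
    (k : ℝ) (hk0 : 0 < k) (hk1 : k < 1)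
    (hK : Kint (Real.sqrt (1 - k ^ 2)) = Real.sqrt r * Kint k) :
    (qPoch (-q) q / qPoch q q) ^ 2 = Real.pi / (2 * Real.sqrt (1 - k ^ 2) * Kint k) := by
  have ht : 0 < Real.sqrt r := Real.sqrt_pos.2 hr
  generalize Real.sqrt r = t at *
  have hratio := qPoch_ratio ht q hq
  have p2 := th2_pos ht
  have p3 := th3_pos ht
  have p4 := th4_pos ht
  have hkk : 0 < 1 - k ^ 2 := by nlinarith
  have hk'p : 0 < Real.sqrt (1 - k ^ 2) := Real.sqrt_pos.2 hkk
  have hk's : k ^ 2 + Real.sqrt (1 - k ^ 2) ^ 2 = 1 := by rw [Real.sq_sqrt hkk.le]; ring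
  generalize Real.sqrt (1 - k ^ 2) = k' at *
  have hj := th_jacobi ht
  have hm : (th2 t ^ 2 / th3 t ^ 2) ^ 2 + (th4 t ^ 2 / th3 t ^ 2) ^ 2 = 1 := by
    field_simp
    linear_combination hj
  have hA := Iab_theta' ht
  have hB : Iab 1 (th2 t ^ 2 / th3 t ^ 2) = t * Iab 1 (th4 t ^ 2 / th3 t ^ 2) := by
    have h := Iab_theta' (t := 1 / t) (by positivity)
    have hst : Real.sqrt t ^ 2 = t := Real.sq_sqrt ht.le
    have hsp : 0 < Real.sqrt t := Real.sqrt_pos.2 ht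
    have e4 : th4 (1 / t) = Real.sqrt t * th2 t := by rw [th2_fe t]; field_simp
    have e3 : th3 (1 / t) = Real.sqrt t * th3 t := by
      have := th3_fe t
      field_simp at this
      rw [← this, mul_comm]
    rw [e4, e3, mul_pow, mul_pow, hst, mul_div_mul_left _ _ ht.ne'] at h
    rw [h, hA]; ring
  rw [Kint_eq hk's, Kint_eq (k' := k) (by linarith)] at hK
  rw [Kint_eq hk's]
  have hx : 0 < th2 t ^ 2 / th3 t ^ 2 := by positivity
  have hy : 0 < th4 t ^ 2 / th3 t ^ 2 := by positivity
  have hkey : k' = th4 t ^ 2 / th3 t ^ 2 := by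
    generalize th4 t ^ 2 / th3 t ^ 2 = y at *
    generalize th2 t ^ 2 / th3 t ^ 2 = x at *
    rcases lt_trichotomy k' y with h | h | h
    · exfalso
      have hk : x < k := by nlinarith
      have h1 := Iab_strict hk'p h
      have h2 := Iab_strict hx hk
      have h3 := mul_lt_mul_of_pos_left h1 ht
      linarith
    · exact h
    · exfalso
      have hk : k < x := by nlinarith
      have h1 := Iab_strict hy h
      have h2 := Iab_strict hk0 hk
      have h3 := mul_lt_mul_of_pos_left h1 ht
      linarith
  have hpi := Real.pi_pos
  rw [hkey, hA, ← inv_div, hratio]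
  field_simp
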